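/- arXiv:1710.08483 — 3 statements merged into one kernel-verified Lean document; each statement's English description precedes it below -/
import Mathlib

section
/- Let ĝ, ĝ′ ∈ ℝⁿ be unit vectors and let A be an invertible n×n matrix such that ⟨ĝ′, A v⟩ = 0 for every v with ⟨ĝ, v⟩ = 0. Then the matrix Ā = A(I − ĝĝᵀ) − ĝ′ĝᵀ is invertible. -/
open Matrix

/-- **Invertibility of the extended reset matrix.**
If `g, g'` are unit vectors and `A` is an invertible matrix carrying `g^⊥` into
`(g')^⊥`, then `Ā = A (I - g gᵀ) - g' gᵀ` is invertible. -/
theorem extended_reset_matrix_invertible {n : ℕ} (A : Matrix (Fin n) (Fin n) ℝ)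
    (hA : IsUnit A) (g g' : Fin n → ℝ) (hg : g ⬝ᵥ g = 1) (hg' : g' ⬝ᵥ g' = 1)
    (horth : ∀ v : Fin n → ℝ, g ⬝ᵥ v = 0 → g' ⬝ᵥ A.mulVec v = 0) :
    IsUnit (A * (1 - vecMulVec g g) - vecMulVec g' g) := by
  rw [← mulVec_injective_iff_isUnit] at hA ⊢
  refine (injective_iff_map_eq_zero (mulVecLin _)).2 fun x hx ↦ ?_
  have hx : A *ᵥ (x - (g ⬝ᵥ x) • g) - (g ⬝ᵥ x) • g' = 0 := by
    simpa [sub_mulVec, ← mulVec_mulVec, vecMulVec_mulVec] using hx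
  have hw : g ⬝ᵥ (x - (g ⬝ᵥ x) • g) = 0 := by
    simp [dotProduct_sub, hg]
  have hgx : g ⬝ᵥ x = 0 := by
    have h := horth _ hw
    rw [sub_eq_zero.1 hx] at h
    simpa [hg'] using h
  apply hA
  simpa [hgx] using hx
end

section
/- Let ĝ, ĝ′ ∈ ℝⁿ be unit vectors and let A be an invertible n×n matrix such that ⟨ĝ′, A v⟩ = 0 for every v with ⟨ĝ, v⟩ = 0, and set Ā = A(I − ĝĝᵀ) − ĝ′ĝᵀ. Then Āᵀ ĝ′ = −ĝ; equivalently, ⟨ĝ, Ā⁻¹ w⟩ = −⟨ĝ′, w⟩ for every w ∈ ℝⁿ. In particular, for any map f′ : ℝⁿ → ℝⁿ, the projected vector field f_e(x) = Ā⁻¹ f′(Ā x + b̄) satisfies ⟨ĝ, f_e(x)⟩ = −⟨ĝ′, f′(Ā x + b̄)⟩ for all x. -/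
open Matrix

/-- The action of `A (I - g gᵀ) - g' gᵀ` on a vector. -/
theorem extended_reset_mulVec {n : ℕ} (A : Matrix (Fin n) (Fin n) ℝ) (g g' v : Fin n → ℝ) :
    (A * (1 - vecMulVec g g) - vecMulVec g' g) *ᵥ v =
      A *ᵥ (v - (g ⬝ᵥ v) • g) - (g ⬝ᵥ v) • g' := by
  simp [sub_mulVec, ← mulVec_mulVec, vecMulVec_mulVec]

/-- `A (I - g gᵀ) - g' gᵀ` negates the normal component. -/
theorem dotProduct_extended_reset_mulVec {n : ℕ} (A : Matrix (Fin n) (Fin n) ℝ)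
    (g g' : Fin n → ℝ) (hg : g ⬝ᵥ g = 1) (hg' : g' ⬝ᵥ g' = 1)
    (horth : ∀ v : Fin n → ℝ, g ⬝ᵥ v = 0 → g' ⬝ᵥ A *ᵥ v = 0) (v : Fin n → ℝ) :
    g' ⬝ᵥ (A * (1 - vecMulVec g g) - vecMulVec g' g) *ᵥ v = -(g ⬝ᵥ v) := by
  rw [extended_reset_mulVec, dotProduct_sub, horth _ (by simp [dotProduct_sub, hg])]
  simp [hg']

/-- `A (I - g gᵀ) - g' gᵀ` is invertible when `A` is. -/
theorem isUnit_extended_reset {n : ℕ} (A : Matrix (Fin n) (Fin n) ℝ) (hA : IsUnit A)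
    (g g' : Fin n → ℝ) (hg : g ⬝ᵥ g = 1) (hg' : g' ⬝ᵥ g' = 1)
    (horth : ∀ v : Fin n → ℝ, g ⬝ᵥ v = 0 → g' ⬝ᵥ A *ᵥ v = 0) :
    IsUnit (A * (1 - vecMulVec g g) - vecMulVec g' g) := by
  rw [← mulVec_injective_iff_isUnit]
  refine (injective_iff_map_eq_zero
    (mulVecLin (A * (1 - vecMulVec g g) - vecMulVec g' g))).2 fun v hv => ?_
  rw [mulVecLin_apply] at hv
  have hgv : g ⬝ᵥ v = 0 := by
    simpa [hv] using dotProduct_extended_reset_mulVec A g g' hg hg' horth v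
  rw [extended_reset_mulVec, hgv] at hv
  refine mulVec_injective_of_isUnit hA ?_
  simpa using hv

/-- **Normal components through the extended reset map.**
With `Ā = A (I - g gᵀ) - g' gᵀ`, one has `Āᵀ g' = -g`; equivalently
`⟨g, Ā⁻¹ w⟩ = -⟨g', w⟩` for every `w`, and in particular the projected vector
field `f_e x = Ā⁻¹ (f' (Ā x + bb))` satisfies
`⟨g, f_e x⟩ = -⟨g', f' (Ā x + bb)⟩` for all `x`. -/
theorem extended_reset_normal_component {n : ℕ} (A : Matrix (Fin n) (Fin n) ℝ)
    (hA : IsUnit A) (g g' : Fin n → ℝ) (hg : g ⬝ᵥ g = 1) (hg' : g' ⬝ᵥ g' = 1)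
    (horth : ∀ v : Fin n → ℝ, g ⬝ᵥ v = 0 → g' ⬝ᵥ A.mulVec v = 0) :
    (A * (1 - vecMulVec g g) - vecMulVec g' g)ᵀ.mulVec g' = -g ∧
    (∀ w : Fin n → ℝ,
      g ⬝ᵥ (A * (1 - vecMulVec g g) - vecMulVec g' g)⁻¹.mulVec w = -(g' ⬝ᵥ w)) ∧
    (∀ (f' : (Fin n → ℝ) → (Fin n → ℝ)) (bb : Fin n → ℝ) (x : Fin n → ℝ),
      g ⬝ᵥ (A * (1 - vecMulVec g g) - vecMulVec g' g)⁻¹.mulVec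
          (f' ((A * (1 - vecMulVec g g) - vecMulVec g' g).mulVec x + bb))
        = -(g' ⬝ᵥ f' ((A * (1 - vecMulVec g g) - vecMulVec g' g).mulVec x + bb))) := by
  have key := dotProduct_extended_reset_mulVec A g g' hg hg' horth
  have hdet := (isUnit_iff_isUnit_det _).1 (isUnit_extended_reset A hA g g' hg hg' horth)
  have hinv : ∀ w : Fin n → ℝ,
      g ⬝ᵥ (A * (1 - vecMulVec g g) - vecMulVec g' g)⁻¹ *ᵥ w = -(g' ⬝ᵥ w) := by
    intro w
    have h := key ((A * (1 - vecMulVec g g) - vecMulVec g' g)⁻¹ *ᵥ w)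
    rw [mulVec_mulVec, mul_nonsing_inv _ hdet, one_mulVec] at h
    rw [h, neg_neg]
  refine ⟨dotProduct_eq _ _ fun v => ?_, hinv, fun f' bb x => hinv _⟩
  rw [mulVec_transpose, ← dotProduct_mulVec, key, neg_dotProduct]
end

section
/- (Lemma 3: equivalence of relaxed flows on partner strips.) Let ε > 0, let φ : ℝ → [0,1] satisfy φ(1 − a) = 1 − φ(a) for all a ∈ ℝ, let ĝ, ĝ′ ∈ ℝⁿ, c, c′ ∈ ℝ with guard functions g(x) = ⟨ĝ, x⟩ − c and g′(y) = ⟨ĝ′, y⟩ − c′, let Ā be an invertible n×n matrix and b̄ᵋ ∈ ℝⁿ, and set R̄ᵋ(x) = Ā x + b̄ᵋ and R̄′ᵋ(y) = Ā⁻¹(y − b̄ᵋ), so that R̄′ᵋ(R̄ᵋ(x)) = x. Assume the strip coordinates are complementary: g′(R̄ᵋ(x)) = ε − g(x) for all x ∈ ℝⁿ. Given f₁, f₂ : ℝⁿ × ℝᵐ → ℝⁿ, define f^ε(x, w) = (1 − φ(g(x)/ε))·f₁(x, w) + φ(g(x)/ε)·Ā⁻¹ f₂(R̄ᵋ(x),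 w) and f′^ε(y, w) = (1 − φ(g′(y)/ε))·f₂(y, w) + φ(g′(y)/ε)·Ā f₁(R̄′ᵋ(y), w). Then for all x ∈ ℝⁿ and w ∈ ℝᵐ, f′^ε(R̄ᵋ(x), w) = Ā f^ε(x, w); consequently, if a curve x : ℝ → ℝⁿ satisfies ẋ(t) = f^ε(x(t), u(t)) at a time t, then the curve s ↦ R̄ᵋ(x(s)) satisfies d/dt R̄ᵋ(x(t)) = f′^ε(R̄ᵋ(x(t)), u(t)) at t. -/
open Matrix

/-- **Lemma 3: equivalence of relaxed flows on partner strips.**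
With complementary strip coordinates `g' (R̄ᵋ x) = ε - g x` and a symmetric blending
function `φ (1 - a) = 1 - φ a`, the relaxed vector fields of partner edges satisfy
`f'^ε (R̄ᵋ x) w = Ā (f^ε x w)`; consequently flows of `f^ε` map to flows of `f'^ε`
under `R̄ᵋ`. -/
theorem relaxed_flows_partner_strips {n m : ℕ} (ε : ℝ) (hε : 0 < ε)
    (φ : ℝ → ℝ) (hφ : ∀ a : ℝ, φ (1 - a) = 1 - φ a)
    (g g' : Fin n → ℝ) (c c' : ℝ)
    (Abar : Matrix (Fin n) (Fin n) ℝ) (hA : IsUnit Abar) (bbar : Fin n → ℝ)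
    (hcompl : ∀ x : Fin n → ℝ, g' ⬝ᵥ (Abar.mulVec x + bbar) - c' = ε - (g ⬝ᵥ x - c))
    (f₁ f₂ : (Fin n → ℝ) → (Fin m → ℝ) → (Fin n → ℝ)) :
    (∀ (x : Fin n → ℝ) (w : Fin m → ℝ),
      (1 - φ ((g' ⬝ᵥ (Abar.mulVec x + bbar) - c') / ε)) • f₂ (Abar.mulVec x + bbar) w
        + φ ((g' ⬝ᵥ (Abar.mulVec x + bbar) - c') / ε) • Abar.mulVec
            (f₁ (Abar⁻¹.mulVec ((Abar.mulVec x + bbar) - bbar)) w)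
      = Abar.mulVec
          ((1 - φ ((g ⬝ᵥ x - c) / ε)) • f₁ x w
            + φ ((g ⬝ᵥ x - c) / ε) • Abar⁻¹.mulVec (f₂ (Abar.mulVec x + bbar) w))) ∧
    (∀ (u : ℝ → Fin m → ℝ) (x : ℝ → Fin n → ℝ) (t : ℝ),
      HasDerivAt x
        ((1 - φ ((g ⬝ᵥ x t - c) / ε)) • f₁ (x t) (u t)
          + φ ((g ⬝ᵥ x t - c) / ε) • Abar⁻¹.mulVec
              (f₂ (Abar.mulVec (x t) + bbar) (u t))) t →
      HasDerivAt (fun s => Abar.mulVec (x s) + bbar)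
        ((1 - φ ((g' ⬝ᵥ (Abar.mulVec (x t) + bbar) - c') / ε)) •
            f₂ (Abar.mulVec (x t) + bbar) (u t)
          + φ ((g' ⬝ᵥ (Abar.mulVec (x t) + bbar) - c') / ε) • Abar.mulVec
              (f₁ (Abar⁻¹.mulVec ((Abar.mulVec (x t) + bbar) - bbar)) (u t))) t) := by
  have hblend : ∀ (x : Fin n → ℝ) (w : Fin m → ℝ),
      (1 - φ ((g' ⬝ᵥ (Abar.mulVec x + bbar) - c') / ε)) • f₂ (Abar.mulVec x + bbar) w
        + φ ((g' ⬝ᵥ (Abar.mulVec x + bbar) - c') / ε) • Abar.mulVec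
            (f₁ (Abar⁻¹.mulVec ((Abar.mulVec x + bbar) - bbar)) w)
      = Abar.mulVec
          ((1 - φ ((g ⬝ᵥ x - c) / ε)) • f₁ x w
            + φ ((g ⬝ᵥ x - c) / ε) • Abar⁻¹.mulVec (f₂ (Abar.mulVec x + bbar) w)) := by
    intro x w
    have hdet : IsUnit Abar.det := (Matrix.isUnit_iff_isUnit_det Abar).mp hA
    rw [hcompl x, sub_div, div_self hε.ne', hφ, add_sub_cancel_right, mulVec_mulVec,
      nonsing_inv_mul _ hdet, one_mulVec, mulVec_add, mulVec_smul, mulVec_smul, mulVec_mulVec,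
      mul_nonsing_inv _ hdet, one_mulVec, sub_sub_cancel, add_comm]
  refine ⟨hblend, fun u x t hx => ?_⟩
  rw [hblend]
  exact (Abar.mulVecLin.toContinuousLinearMap.hasFDerivAt.comp_hasDerivAt t hx).add_const bbar
end
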